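/- Let N be an infinite, finitely generated nilpotent group with finite generating set S such that the quotient N/T(N) is abelian. Then Farb_{N,S}(n) ≈ log(n). -/

import Mathlib

open Subgroup

/-- Word length of `g` with respect to a generating set `S`: the least length of a word in
`S ∪ S⁻¹` representing `g`. -/
noncomputable def wordLength {G : Type*} [Group G] (S : Set G) (g : G) : ℕ :=
  sInf {n : ℕ | ∃ w : List G, w.length = n ∧ (∀ x ∈ w, x ∈ S ∨ x⁻¹ ∈ S) ∧ w.prod = g}

/-- The depth `D_G(g)`: the minimal order of a finite group admitting a surjective
homomorphism from `G` that does not kill `g`. -/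
noncomputable def depthFn {G : Type*} [Group G] (g : G) : ℕ :=
  sInf {n : ℕ | ∃ (Q : Type) (_ : Group Q) (_ : Fintype Q) (φ : G →* Q),
    Function.Surjective φ ∧ φ g ≠ 1 ∧ Fintype.card Q = n}

/-- The residual finiteness function `Farb_{G,S}(n)`: the maximum of `D_G(g)` over nontrivial
`g` of word length at most `n`. -/
noncomputable def Farb {G : Type*} [Group G] (S : Set G) (n : ℕ) : ℕ :=
  sSup {d : ℕ | ∃ g : G, g ≠ 1 ∧ wordLength S g ≤ n ∧ depthFn g = d}

/-- `f ≾ g` : there is a constant `C > 0` with `f n ≤ C * g (C * n)` for all `n`. -/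
def Precsim (f g : ℕ → ℕ) : Prop := ∃ C : ℕ, 0 < C ∧ ∀ n, f n ≤ C * g (C * n)

/-- `f ≈ g` : `f ≾ g` and `g ≾ f`. -/
def AsympEquiv (f g : ℕ → ℕ) : Prop := Precsim f g ∧ Precsim g f


open scoped commutatorElement IsMulCommutative

section CommGroup

/-- A finitely generated abelian group maps to a free abelian group of finite rank with kernel of
bounded exponent. -/
theorem exists_hom_pi_int_ker_pow_eq_one (A : Type*) [CommGroup A] [Group.FG A] :
    ∃ (j : Type) (_ : Finite j) (f : A →* (j → Multiplicative ℤ)) (M : ℕ), M ≠ 0 ∧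
      ∀ a, f a = 1 → a ^ M = 1 := by
  obtain ⟨ι, j, _, _, p, hp, e, ⟨E⟩⟩ := CommGroup.equiv_free_prod_prod_multiplicative_zmod A
  have (i : ι) : NeZero (p i ^ e i) := ⟨pow_ne_zero _ (hp i).ne_zero⟩
  refine ⟨j, inferInstance, (MonoidHom.fst _ _).comp E.toMonoidHom,
    Nat.card ((i : ι) → Multiplicative (ZMod (p i ^ e i))), Nat.card_pos.ne', fun a ha => ?_⟩
  apply E.injective
  rw [map_pow, map_one]
  refine Prod.ext ?_ pow_card_eq_one'
  have ha' : (E a).1 = 1 := ha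
  rw [Prod.pow_fst, ha', one_pow, Prod.fst_one]

end CommGroup

section Nilpotent

variable {G : Type*} [Group G]

theorem commutator_mem_center_of_mem_secondCenter {k : G}
    (hk : k ∈ (center (G ⧸ center G)).comap (QuotientGroup.mk' (center G))) (s : G) :
    ⁅k, s⁆ ∈ center G := by
  rw [← QuotientGroup.eq_one_iff, ← QuotientGroup.mk'_apply, map_commutatorElement,
    commutatorElement_eq_one_iff_mul_comm]
  exact (mem_center_iff.1 (mem_comap.1 hk) _).symm

/-- Commutation with `s`, as a homomorphism from the second center to the center. -/
def secondCenterCommutatorHom (s : G) :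
    (center (G ⧸ center G)).comap (QuotientGroup.mk' (center G)) →* center G where
  toFun k := ⟨⁅(k : G), s⁆, commutator_mem_center_of_mem_secondCenter k.2 s⟩
  map_one' := by simp
  map_mul' a b := by
    have hb := commutator_mem_center_of_mem_secondCenter b.2 s
    ext
    have h' := mem_center_iff.1 hb (s * (a : G)⁻¹ * s⁻¹)
    calc ⁅(a * b : G), s⁆ = (a * ⁅(b : G), s⁆) * (s * (a : G)⁻¹ * s⁻¹) := by
          simp only [commutatorElement_def]; group
      _ = a * ((s * (a : G)⁻¹ * s⁻¹) * ⁅(b : G), s⁆) := by rw [h', mul_assoc]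
      _ = ⁅(a : G), s⁆ * ⁅(b : G), s⁆ := by simp only [commutatorElement_def]; group

theorem coe_secondCenterCommutatorHom_apply (s : G)
    (k : (center (G ⧸ center G)).comap (QuotientGroup.mk' (center G))) :
    (secondCenterCommutatorHom s k : G) = ⁅(k : G), s⁆ := rfl

/-- In a finitely generated group whose commutators are torsion, the center has finite index as
soon as the second center does. -/
theorem finiteIndex_center_of_finiteIndex_secondCenter [Group.FG G]
    (htor : ∀ a b : G, IsOfFinOrder ⁅a, b⁆) [(center (G ⧸ center G)).FiniteIndex] :
    (center G).FiniteIndex := by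
  set K := (center (G ⧸ center G)).comap (QuotientGroup.mk' (center G)) with hK
  obtain ⟨S, hS⟩ := Group.fg_def.1 ‹Group.FG G›
  have hKfin : K.FiniteIndex := by
    constructor
    rw [hK, index_comap_of_surjective _ (QuotientGroup.mk'_surjective _)]
    exact FiniteIndex.index_ne_zero
  have hle : center G ≤ K := fun z hz => by
    rw [hK, mem_comap, QuotientGroup.mk'_apply, (QuotientGroup.eq_one_iff z).2 hz]
    exact one_mem _
  have hker (s : G) : (secondCenterCommutatorHom s).ker.FiniteIndex := by
    have : Group.FG (secondCenterCommutatorHom s).range := Group.fg_range _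
    have : Finite (secondCenterCommutatorHom s).range := by
      apply CommGroup.finite_of_fg_isMulTorsion
      rintro ⟨_, k, rfl⟩
      have := htor k s
      rw [← coe_secondCenterCommutatorHom_apply] at this
      exact Submonoid.isOfFinOrder_coe.1 (Submonoid.isOfFinOrder_coe.1 this)
    infer_instance
  have hinf : (⨅ s : S, (secondCenterCommutatorHom (s : G)).ker).FiniteIndex :=
    finiteIndex_iInf fun s => hker s
  have hsub : (⨅ s : S, (secondCenterCommutatorHom (s : G)).ker) ≤ (center G).subgroupOf K := by
    intro k hk
    rw [mem_subgroupOf, ← centralizer_univ, ← coe_top, ← hS, centralizer_closure,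
      mem_centralizer_iff]
    intro s hs
    have h := (mem_iInf.1 hk) ⟨s, hs⟩
    rw [MonoidHom.mem_ker, Subtype.ext_iff, coe_secondCenterCommutatorHom_apply] at h
    exact (commutatorElement_eq_one_iff_mul_comm.1 h).symm
  have := finiteIndex_of_le hsub
  constructor
  rw [← relIndex_mul_index hle]
  exact mul_ne_zero this.index_ne_zero hKfin.index_ne_zero

/-- A finitely generated nilpotent group whose commutators are torsion has a center of finite
index. -/
theorem finiteIndex_center_of_isOfFinOrder_commutator (G : Type*) [Group G] [Group.IsNilpotent G]
    [hfg : Group.FG G] (htor : ∀ a b : G, IsOfFinOrder ⁅a, b⁆) : (center G).FiniteIndex := by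
  refine Group.nilpotent_center_quotient_ind (P := fun G _ _ => Group.FG G →
    (∀ a b : G, IsOfFinOrder ⁅a, b⁆) → (center G).FiniteIndex) G ?_ ?_ hfg htor
  · intro G _ _ _ _
    infer_instance
  · intro G _ _ ih _ htor
    have := ih inferInstance fun a b => by
      obtain ⟨a, rfl⟩ := QuotientGroup.mk'_surjective _ a
      obtain ⟨b, rfl⟩ := QuotientGroup.mk'_surjective _ b
      rw [← map_commutatorElement]
      exact (QuotientGroup.mk' (center G)).isOfFinOrder (htor a b)
    exact finiteIndex_center_of_finiteIndex_secondCenter htor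

/-- A finitely generated nilpotent group whose commutators are torsion has a torsion-free normal
subgroup of finite index. -/
theorem exists_normal_finiteIndex_torsionFree [Group.IsNilpotent G] [Group.FG G]
    (htor : ∀ a b : G, IsOfFinOrder ⁅a, b⁆) :
    ∃ A : Subgroup G, A.Normal ∧ A.FiniteIndex ∧ ∀ g ∈ A, IsOfFinOrder g → g = 1 := by
  have := finiteIndex_center_of_isOfFinOrder_commutator G htor
  obtain ⟨j, _, f, M, hM, hf⟩ := exists_hom_pi_int_ker_pow_eq_one (center G)
  have hpow := finiteIndex_range_powMonoidHom_of_fg (center G) hM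
  refine ⟨(powMonoidHom (α := center G) M).range.map (center G).subtype, ⟨?_⟩, ⟨?_⟩, ?_⟩
  · rintro _ ⟨z, hz, rfl⟩ g
    refine ⟨z, hz, ?_⟩
    rw [subtype_apply, mem_center_iff.1 z.2 g, mul_inv_cancel_right]
  · rw [index_map_subtype]
    exact mul_ne_zero hpow.index_ne_zero FiniteIndex.index_ne_zero
  · rintro _ ⟨_, ⟨z, rfl⟩, rfl⟩ h
    have hz : IsOfFinOrder z := Submonoid.isOfFinOrder_coe.1 (IsOfFinOrder.of_pow h hM)
    rw [powMonoidHom_apply, hf z, map_one]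
    funext i
    exact (isOfFinOrder_iff_eq_one _).1 ((f.isOfFinOrder hz).apply i)

end Nilpotent

section WordLength

variable {G : Type*} [Group G]

theorem exists_list_of_closure_eq_top {S : Set G} (hgen : closure S = ⊤) (g : G) :
    ∃ w : List G, (∀ x ∈ w, x ∈ S ∨ x⁻¹ ∈ S) ∧ w.prod = g := by
  have hg : g ∈ (closure S).toSubmonoid := by simp [hgen]
  rw [closure_toSubmonoid] at hg
  simpa using Submonoid.exists_list_of_mem_closure hg

/-- Every element is represented by a word of length equal to its word length. -/
theorem exists_list_length_eq_wordLength {S : Set G} (hgen : closure S = ⊤) (g : G) :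
    ∃ w : List G, w.length = wordLength S g ∧ (∀ x ∈ w, x ∈ S ∨ x⁻¹ ∈ S) ∧ w.prod = g := by
  obtain ⟨w, hw, hg⟩ := exists_list_of_closure_eq_top hgen g
  exact Nat.sInf_mem (s := {n : ℕ | ∃ w : List G, w.length = n ∧ (∀ x ∈ w, x ∈ S ∨ x⁻¹ ∈ S) ∧
    w.prod = g}) ⟨w.length, w, rfl, hw, hg⟩

theorem wordLength_pow_le {S : Set G} (hgen : closure S = ⊤) (g : G) (k : ℕ) :
    wordLength S (g ^ k) ≤ k * wordLength S g := by
  obtain ⟨w, hlen, hw, hg⟩ := exists_list_length_eq_wordLength hgen g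
  refine Nat.sInf_le ⟨(List.replicate k w).flatten, ?_, ?_, ?_⟩
  · simp [hlen]
  · intro x hx
    obtain ⟨l, hl, hxl⟩ := List.mem_flatten.1 hx
    rw [List.eq_of_mem_replicate hl] at hxl
    exact hw x hxl
  · simp [List.prod_flatten, hg]

/-- A homomorphism to `ℤ` bounded by `c` on the generators is `c`-Lipschitz for word length. -/
theorem natAbs_hom_le_mul_wordLength {S : Set G} (hgen : closure S = ⊤)
    (f : G →* Multiplicative ℤ) {c : ℕ} (hc : ∀ s ∈ S, (f s).toAdd.natAbs ≤ c) (g : G) :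
    (f g).toAdd.natAbs ≤ c * wordLength S g := by
  obtain ⟨w, hlen, hw, rfl⟩ := exists_list_length_eq_wordLength hgen g
  rw [← hlen]
  clear hlen
  induction w with
  | nil => simp
  | cons a w ih =>
    have ha : (f a).toAdd.natAbs ≤ c := by
      rcases hw a (by simp) with h | h
      · exact hc a h
      · simpa using hc _ h
    have hi := ih fun x hx => hw x (List.mem_cons_of_mem _ hx)
    rw [List.prod_cons, map_mul, toAdd_mul, List.length_cons, mul_add, mul_one]
    exact (Int.natAbs_add_le _ _).trans (by omega)

end WordLength

section Depth

variable {G : Type*} [Group G]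

/-- Any homomorphism to a finite group that does not kill `g` bounds the depth of `g`. The depth is
then positive, i.e. it is not the infimum of the empty set. -/
theorem depthFn_pos_and_le_card {Q : Type*} [Group Q] [Finite Q] (φ : G →* Q) {g : G}
    (hg : φ g ≠ 1) : 0 < depthFn g ∧ depthFn g ≤ Nat.card Q := by
  have hsmall : Small.{0} φ.range := Countable.toSmall _
  have : Finite (Shrink.{0} φ.range) := Finite.of_equiv _ (equivShrink.{0} φ.range)
  have := Fintype.ofFinite (Shrink.{0} φ.range)
  let e : φ.range ≃* Shrink.{0} φ.range := Shrink.mulEquiv.symm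
  have hmem : Nat.card φ.range ∈ {n : ℕ | ∃ (Q : Type) (_ : Group Q) (_ : Fintype Q) (φ : G →* Q),
      Function.Surjective φ ∧ φ g ≠ 1 ∧ Fintype.card Q = n} := by
    refine ⟨Shrink.{0} φ.range, inferInstance, inferInstance,
      e.toMonoidHom.comp φ.rangeRestrict, e.surjective.comp φ.rangeRestrict_surjective,
      fun h => ?_, by rw [← Nat.card_eq_fintype_card, Nat.card_congr e.toEquiv]⟩
    have h' : φ.rangeRestrict g = 1 := e.injective (h.trans (map_one _).symm)
    exact hg (congrArg Subtype.val h')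
  obtain ⟨P, _, _, ψ, -, -, hcard⟩ := Nat.sInf_mem ⟨_, hmem⟩
  exact ⟨Fintype.card_pos.trans_eq hcard, (Nat.sInf_le hmem).trans
    (Nat.card_le_card_of_injective _ φ.range.subtype_injective)⟩

/-- Every finite quotient of order at most `k` kills the `lcm(1, …, k)`-th powers. -/
theorem lt_depthFn_pow_lcmUpto {x : G} {k : ℕ} (hpos : 0 < depthFn (x ^ Nat.lcmUpto k)) :
    k < depthFn (x ^ Nat.lcmUpto k) := by
  obtain ⟨P, _, _, ψ, -, hψ, hcard⟩ := Nat.sInf_mem (Nat.nonempty_of_pos_sInf hpos)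
  by_contra! hle
  apply hψ
  have hdvd : Fintype.card P ∣ Nat.lcmUpto k :=
    Finset.dvd_lcm (f := id) (Finset.mem_Icc.2 ⟨Fintype.card_pos, hcard.trans_le hle⟩)
  rw [map_pow]
  exact orderOf_dvd_iff_pow_eq_one.1 (orderOf_dvd_card.trans hdvd)

end Depth

section Arithmetic

theorem lcmUpto_le_two_pow (k : ℕ) : Nat.lcmUpto k ≤ 2 ^ (8 * k) := by
  have h := Chebyshev.psi_le_const_mul_self (Nat.cast_nonneg (α := ℝ) k)
  rw [Chebyshev.psi_eq_log_lcmUpto] at h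
  have h4 : Real.log 4 = 2 * Real.log 2 := by
    rw [show (4 : ℝ) = 2 ^ 2 by norm_num, Real.log_pow]; norm_num
  have h2 := Real.log_two_gt_d9
  have hpos : (0 : ℝ) < Nat.lcmUpto k := by exact_mod_cast Nat.lcmUpto_pos k
  have hlog : Real.log (Nat.lcmUpto k) ≤ Real.log ((2 : ℝ) ^ (8 * k)) := by
    rw [Real.log_pow]
    push_cast
    have hk : (0 : ℝ) ≤ k := Nat.cast_nonneg k
    nlinarith
  exact_mod_cast (Real.log_le_log_iff hpos (by positivity)).1 hlog

/-- A nonzero natural number `m` has a non-divisor of size `O(log m)`. -/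
theorem exists_not_dvd_le_log {m : ℕ} (hm : m ≠ 0) :
    ∃ q, q ≠ 0 ∧ q ≤ 4 * (Nat.log 2 m + 1) ∧ ¬ q ∣ m := by
  by_contra! h
  set l := Nat.log 2 m + 1 with hl
  have hdvd : Nat.lcmUpto (4 * l) ∣ m := Finset.lcm_dvd fun q hq => by
    rw [Finset.mem_Icc] at hq
    exact h q (by omega) hq.2
  have hle := Nat.le_of_dvd (Nat.pos_of_ne_zero hm) hdvd
  have hlow := Chebyshev.two_pow_le_mul_lcmUpto (4 * l)
  have hlt : m < 2 ^ l := Nat.lt_pow_succ_log_self one_lt_two m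
  have hl2 : l < 2 ^ l := Nat.lt_two_pow_self
  have h1 : 2 ≤ 2 ^ l := by
    calc 2 = 2 ^ 1 := rfl
      _ ≤ 2 ^ l := Nat.pow_le_pow_right two_pos (by omega)
  have : (4 * l + 1) * Nat.lcmUpto (4 * l) < 2 ^ (4 * l) := by
    calc (4 * l + 1) * Nat.lcmUpto (4 * l) ≤ (4 * l + 1) * m := Nat.mul_le_mul_left _ hle
      _ < (2 ^ l * 2 ^ l * 2 ^ l) * 2 ^ l := by
        apply Nat.mul_lt_mul_of_le_of_lt _ hlt (by positivity)
        nlinarith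
      _ = 2 ^ (4 * l) := by ring
  omega

end Arithmetic

section Farb

variable {G : Type*} [Group G]

/-- Depth is at most logarithmic in word length for a group whose elements are separated by one
finite quotient together with finitely many homomorphisms to `ℤ`. -/
theorem exists_depthFn_le_log {S : Set G} (hS : S.Finite) (hgen : closure S = ⊤)
    {Q : Type*} [Group Q] [Finite Q] (φ : G →* Q) {j : Type*} [Finite j]
    (f : j → G →* Multiplicative ℤ) (hsep : ∀ g, φ g = 1 → (∀ i, f i g = 1) → g = 1) :
    ∃ C : ℕ, 0 < C ∧ ∀ n, ∀ g : G, g ≠ 1 → wordLength S g ≤ n →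
      0 < depthFn g ∧ depthFn g ≤ C * Nat.log 2 (C * n) := by
  obtain ⟨c, hc⟩ : ∃ c, ∀ i, ∀ s ∈ S, (f i s).toAdd.natAbs ≤ c := by
    have := hS.to_subtype
    obtain ⟨c, hc⟩ := (Set.finite_range fun p : j × S => (f p.1 p.2).toAdd.natAbs).bddAbove
    exact ⟨c, fun i s hs => hc ⟨(i, ⟨s, hs⟩), rfl⟩⟩
  set C := 2 * (c + 1) + Nat.card Q + 4 with hC
  refine ⟨C, by omega, fun n g hg hn => ?_⟩
  have hn0 : n ≠ 0 := by
    rintro rfl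
    obtain ⟨w, hlen, -, rfl⟩ := exists_list_length_eq_wordLength hgen g
    rw [Nat.le_zero.1 hn, List.length_eq_zero_iff] at hlen
    exact hg (by simp [hlen])
  have hlog : Nat.log 2 (c * n) + 1 ≤ Nat.log 2 (C * n) := by
    calc Nat.log 2 (c * n) + 1 ≤ Nat.log 2 ((c + 1) * n) + 1 :=
          Nat.add_le_add_right (Nat.log_mono_right (Nat.mul_le_mul_right _ (by omega))) _
      _ = Nat.log 2 ((c + 1) * n * 2) :=
          (Nat.log_mul_base one_lt_two (Nat.mul_ne_zero (by omega) hn0)).symm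
      _ ≤ Nat.log 2 (C * n) := Nat.log_mono_right (by nlinarith)
  by_cases hφ : φ g = 1
  · obtain ⟨i, hi⟩ : ∃ i, f i g ≠ 1 := by
      by_contra! h
      exact hg (hsep g hφ h)
    obtain ⟨q, hq0, hq, hdvd⟩ := exists_not_dvd_le_log (m := (f i g).toAdd.natAbs)
      (by simpa using hi)
    have : NeZero q := ⟨hq0⟩
    obtain ⟨hpos, hdepth⟩ := depthFn_pos_and_le_card (g := g)
      ((AddMonoidHom.toMultiplicative (Int.castAddHom (ZMod q))).comp (f i)) (fun h => hdvd (by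
        have h' : (((f i g).toAdd : ℤ) : ZMod q) = 0 := h
        rw [ZMod.intCast_zmod_eq_zero_iff_dvd] at h'
        exact Int.natCast_dvd.1 h'))
    have hcard : Nat.card (Multiplicative (ZMod q)) = q := Nat.card_zmod q
    have hmono : Nat.log 2 (f i g).toAdd.natAbs ≤ Nat.log 2 (c * n) :=
      Nat.log_mono_right ((natAbs_hom_le_mul_wordLength hgen (f i) (hc i) g).trans
        (Nat.mul_le_mul_left _ hn))
    refine ⟨hpos, ?_⟩
    calc depthFn g ≤ 4 * Nat.log 2 (C * n) := by omega
      _ ≤ C * Nat.log 2 (C * n) := Nat.mul_le_mul_right _ (by omega)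
  · obtain ⟨hpos, hdepth⟩ := depthFn_pos_and_le_card φ hφ
    refine ⟨hpos, ?_⟩
    calc depthFn g ≤ Nat.card Q := hdepth
      _ ≤ C * 1 := by omega
      _ ≤ C * Nat.log 2 (C * n) := Nat.mul_le_mul_left _ (by omega)

/-- `Farb S` is at least logarithmic in a residually finite group (`hpos`) with an element of
infinite order, provided the depths entering each value of `Farb S` are bounded. -/
theorem log_precsim_Farb {S : Set G} (hgen : closure S = ⊤)
    (hbdd : ∀ n, BddAbove {d : ℕ | ∃ g : G, g ≠ 1 ∧ wordLength S g ≤ n ∧ depthFn g = d})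
    (hpos : ∀ g : G, g ≠ 1 → 0 < depthFn g)
    {x : G} (hx : ¬ IsOfFinOrder x) : Precsim (fun n => Nat.log 2 n) (Farb S) := by
  refine ⟨wordLength S x + 8, by omega, fun n => ?_⟩
  rcases eq_or_ne n 0 with rfl | hn
  · simp
  set k := Nat.log 2 n / 8 with hk
  have hg : x ^ Nat.lcmUpto k ≠ 1 := fun h =>
    hx (isOfFinOrder_iff_pow_eq_one.2 ⟨_, Nat.lcmUpto_pos k, h⟩)
  have hlcm : Nat.lcmUpto k ≤ n :=
    calc Nat.lcmUpto k ≤ 2 ^ (8 * k) := lcmUpto_le_two_pow k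
      _ ≤ 2 ^ Nat.log 2 n := Nat.pow_le_pow_right two_pos (by omega)
      _ ≤ n := Nat.pow_log_le_self 2 hn
  have hlen : wordLength S (x ^ Nat.lcmUpto k) ≤ (wordLength S x + 8) * n :=
    (wordLength_pow_le hgen x _).trans (by nlinarith)
  have hFarb : k < Farb S ((wordLength S x + 8) * n) :=
    (lt_depthFn_pow_lcmUpto (hpos _ hg)).trans_le (le_csSup (hbdd _) ⟨_, hg, hlen, rfl⟩)
  calc Nat.log 2 n ≤ 8 * (k + 1) := by omega
    _ ≤ (wordLength S x + 8) * Farb S ((wordLength S x + 8) * n) :=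
      Nat.mul_le_mul (by omega) hFarb

end Farb

/-- Let `N` be an infinite, finitely generated nilpotent group with finite generating set `S`
such that `N/T(N)` is abelian (`T` is the torsion subgroup, i.e. the subgroup of elements of
finite order). Then `Farb_{N,S}(n) ≈ log n`. -/
theorem stmt1 (N : Type*) [Group N] [Group.IsNilpotent N] [Infinite N]
    (S : Set N) (hS : S.Finite) (hgen : Subgroup.closure S = ⊤)
    (T : Subgroup N) (hT : T.Normal) (hTtor : ∀ g : N, g ∈ T ↔ IsOfFinOrder g)
    (hab : ∀ a b : N ⧸ T, a * b = b * a) :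
    AsympEquiv (Farb S) (fun n => Nat.log 2 n) := by
  have : Group.FG N := Group.fg_iff.2 ⟨S, hgen, hS⟩
  have htor (a b : N) : IsOfFinOrder ⁅a, b⁆ := by
    rw [← hTtor, ← QuotientGroup.eq_one_iff, ← QuotientGroup.mk'_apply, map_commutatorElement,
      commutatorElement_eq_one_iff_mul_comm]
    exact hab _ _
  obtain ⟨A, _, _, hA⟩ := exists_normal_finiteIndex_torsionFree htor
  have : IsMulCommutative (N ⧸ T) := ⟨⟨hab⟩⟩
  obtain ⟨j, _, f, M, hM, hf⟩ := exists_hom_pi_int_ker_pow_eq_one (N ⧸ T)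
  have hsep (g : N) (hgA : QuotientGroup.mk' A g = 1)
      (hgf : ∀ i, ((Pi.evalMonoidHom _ i).comp (f.comp (QuotientGroup.mk' T))) g = 1) :
      g = 1 := by
    refine hA g ((QuotientGroup.eq_one_iff g).1 hgA) (IsOfFinOrder.of_pow (n := M) ?_ hM)
    rw [← hTtor, ← QuotientGroup.eq_one_iff]
    exact hf g (funext hgf)
  obtain ⟨C, hC, hle⟩ := exists_depthFn_le_log hS hgen (QuotientGroup.mk' A) _ hsep
  refine ⟨⟨C, hC, fun n => csSup_le' ?_⟩, ?_⟩
  · rintro _ ⟨g, hg, hn, rfl⟩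
    exact (hle n g hg hn).2
  obtain ⟨x, hx⟩ : ∃ x : N, ¬ IsOfFinOrder x := by
    by_contra! h
    have hbot : A = ⊥ := (eq_bot_iff_forall A).2 fun g hg => hA g hg (h g)
    have : (⊥ : Subgroup N).FiniteIndex := hbot ▸ ‹A.FiniteIndex›
    exact not_finite_iff_infinite.2 ‹_›
      ((finite_iff_finite_and_finiteIndex ⊥).2 ⟨inferInstance, this⟩)
  refine log_precsim_Farb hgen (fun n => ⟨C * Nat.log 2 (C * n), ?_⟩)
    (fun g hg => (hle _ g hg le_rfl).1) hx
  rintro _ ⟨g, hg, hn, rfl⟩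
  exact (hle n g hg hn).2
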